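/- Let s ≥ 1 and c be natural numbers, let T be a finite set of transactions, and let acc : T → Finset (Fin s) have per-shard congestion at most c. Then the number of heavy transactions, i.e. transactions t with |acc(t)| > ⌈√s⌉, is at most c·⌈√s⌉. -/

import Mathlib

/-- Heavy-transaction counting step of Case 2 of Lemma 4.2: if each of the `s` shards is
accessed by at most `c` transactions, then the number of heavy transactions (those
accessing more than `⌈√s⌉` shards) is at most `c·⌈√s⌉`. -/
theorem heavy_transaction_count_le {T : Type} [Fintype T] (s c : ℕ) (hs : 1 ≤ s)
    (acc : T → Finset (Fin s))
    (hcong : ∀ j : Fin s, (Finset.univ.filter (fun t : T => j ∈ acc t)).card ≤ c) :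
    (Finset.univ.filter (fun t : T => ⌈Real.sqrt s⌉₊ < (acc t).card)).card
      ≤ c * ⌈Real.sqrt s⌉₊ := by
  set k := ⌈Real.sqrt s⌉₊ with hk
  have hk_pos : 0 < k := Nat.ceil_pos.2 (Real.sqrt_pos.2 (by exact_mod_cast hs))
  have hsk : s ≤ k * k := by
    have h : (s : ℝ) ≤ (k : ℝ) ^ 2 := (Real.sqrt_le_left (Nat.cast_nonneg k)).1 (Nat.le_ceil _)
    rw [← sq]
    exact_mod_cast h
  have hcount : (Finset.univ.filter (fun t : T => k < (acc t).card)).card * k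
      ≤ (Finset.univ : Finset (Fin s)).card * c := by
    refine Finset.card_mul_le_card_mul (fun t j => j ∈ acc t) (fun t ht => ?_) (fun j _ => ?_)
    · simpa [Finset.bipartiteAbove] using (Finset.mem_filter.1 ht).2.le
    · exact (Finset.card_le_card
        (Finset.filter_subset_filter _ (Finset.subset_univ _))).trans (hcong j)
  rw [Finset.card_univ, Fintype.card_fin] at hcount
  refine Nat.le_of_mul_le_mul_right ?_ hk_pos
  calc _ ≤ s * c := hcount
    _ ≤ k * k * c := Nat.mul_le_mul_right c hsk
    _ = c * k * k := by ring
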